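/- arXiv:2411.03181 — 3 statements merged into one kernel-verified Lean document; each statement's English description precedes it below -/
import Mathlib

section
/- The unique point $x_m \in (0,\infty)$ at which the real Gamma function attains its minimum on $(0,\infty)$ satisfies $1.46163214 < x_m < 1.46163215$. -/
open Filter Topology Set

/-- A function on `(0,∞)` that vanishes at infinity and does not increase under unit shifts is
nonnegative. -/
lemma nonneg_of_add_one_le_of_tendsto_zero {e : ℝ → ℝ} (hstep : ∀ x, 0 < x → e (x + 1) ≤ e x)
    (hlim : Tendsto e atTop (𝓝 0)) {x : ℝ} (hx : 0 < x) : 0 ≤ e x := by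
  have hle : ∀ n : ℕ, e (x + n) ≤ e x := by
    intro n
    induction n with
    | zero => simp
    | succ n ih =>
      have h := hstep (x + n) (by positivity)
      rw [add_assoc] at h
      push_cast
      exact h.trans ih
  exact le_of_tendsto (hlim.comp (tendsto_atTop_add_const_left _ x tendsto_natCast_atTop_atTop))
    (Eventually.of_forall hle)

lemma nonpos_of_le_add_one_of_tendsto_zero {e : ℝ → ℝ} (hstep : ∀ x, 0 < x → e x ≤ e (x + 1))
    (hlim : Tendsto e atTop (𝓝 0)) {x : ℝ} (hx : 0 < x) : e x ≤ 0 := by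
  have h := nonneg_of_add_one_le_of_tendsto_zero (e := fun y => -e y)
    (fun y hy => neg_le_neg (hstep y hy)) (by simpa using hlim.neg) hx
  linarith

/-- The truncated asymptotic expansion of the digamma function, with the coefficient of `x⁻⁶`
left free. -/
noncomputable def digammaApprox (c x : ℝ) : ℝ :=
  Real.log x - (1 / 2 * x⁻¹ + 1 / 12 * x⁻¹ ^ 2 - 1 / 120 * x⁻¹ ^ 4 + c * x⁻¹ ^ 6)

lemma hasDerivAt_digammaApprox (c : ℝ) {x : ℝ} (hx : 0 < x) :
    HasDerivAt (digammaApprox c)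
      (x⁻¹ + 1 / 2 * x⁻¹ ^ 2 + 1 / 6 * x⁻¹ ^ 3 - 1 / 30 * x⁻¹ ^ 5 + 6 * c * x⁻¹ ^ 7) x := by
  have hi : HasDerivAt (fun y : ℝ => y⁻¹) (-(x ^ 2)⁻¹) x := hasDerivAt_inv hx.ne'
  have h := (Real.hasDerivAt_log hx.ne').sub
    ((((hi.const_mul (1 / 2)).add ((hi.pow 2).const_mul (1 / 12))).sub
      ((hi.pow 4).const_mul (1 / 120))).add ((hi.pow 6).const_mul c))
  refine h.congr_deriv ?_
  rw [← inv_pow]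
  push_cast
  ring

lemma tendsto_digammaApprox_sub_log (c : ℝ) :
    Tendsto (fun x => digammaApprox c x - Real.log x) atTop (𝓝 0) := by
  have hi : Tendsto (fun x : ℝ => x⁻¹) atTop (𝓝 0) := tendsto_inv_atTop_zero
  have h := ((((hi.const_mul (1 / 2)).add ((hi.pow 2).const_mul (1 / 12))).sub
      ((hi.pow 4).const_mul (1 / 120))).add ((hi.pow 6).const_mul c)).neg
  simp only [digammaApprox]
  refine (h.congr fun x => ?_).trans (by norm_num)
  ring

/-- The defect of `digammaApprox c` in the functional equation `ψ (x + 1) = ψ x + 1 / x`. -/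
noncomputable def digammaApproxDefect (c x : ℝ) : ℝ :=
  digammaApprox c (x + 1) - digammaApprox c x - x⁻¹

lemma tendsto_digammaApproxDefect (c : ℝ) :
    Tendsto (digammaApproxDefect c) atTop (𝓝 0) := by
  have h0 := tendsto_digammaApprox_sub_log c
  have h1 := h0.comp (tendsto_atTop_add_const_right _ (1 : ℝ) tendsto_id)
  have hi : Tendsto (fun x : ℝ => x⁻¹) atTop (𝓝 0) := tendsto_inv_atTop_zero
  have hl : Tendsto (fun x : ℝ => Real.log (1 + x⁻¹)) atTop (𝓝 0) := by
    have := (hi.const_add 1).log (by norm_num)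
    simpa using this
  have h := ((h1.sub h0).add hl).sub hi
  simp only [sub_zero, add_zero] at h
  refine h.congr' ?_
  filter_upwards [eventually_gt_atTop 0] with x hx
  have : Real.log (1 + x⁻¹) = Real.log (x + 1) - Real.log x := by
    rw [← Real.log_div (by positivity) hx.ne']
    congr 1
    field_simp
  simp only [Function.comp, id, digammaApproxDefect, this]
  ring

lemma hasDerivAt_digammaApproxDefect (c : ℝ) {x : ℝ} (hx : 0 < x) :
    HasDerivAt (digammaApproxDefect c)
      (((x + 1)⁻¹ + 1 / 2 * (x + 1)⁻¹ ^ 2 + 1 / 6 * (x + 1)⁻¹ ^ 3 - 1 / 30 * (x + 1)⁻¹ ^ 5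
          + 6 * c * (x + 1)⁻¹ ^ 7)
        - (x⁻¹ + 1 / 2 * x⁻¹ ^ 2 + 1 / 6 * x⁻¹ ^ 3 - 1 / 30 * x⁻¹ ^ 5 + 6 * c * x⁻¹ ^ 7)
        + x⁻¹ ^ 2) x := by
  have h := (((hasDerivAt_digammaApprox c (by positivity : 0 < x + 1)).comp_add_const x 1).sub
    (hasDerivAt_digammaApprox c hx)).sub (hasDerivAt_inv hx.ne')
  refine h.congr_deriv ?_
  rw [← inv_pow]
  ring

lemma digammaApproxDefect_zero_nonpos {x : ℝ} (hx : 0 < x) : digammaApproxDefect 0 x ≤ 0 := by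
  have hmono : MonotoneOn (digammaApproxDefect 0) (Ioi 0) := by
    refine monotoneOn_of_deriv_nonneg (convex_Ioi 0)
      (fun y hy => (hasDerivAt_digammaApproxDefect 0 hy).continuousAt.continuousWithinAt)
      (fun y hy => (hasDerivAt_digammaApproxDefect 0
        (interior_subset hy)).differentiableAt.differentiableWithinAt) fun y hy => ?_
    replace hy : 0 < y := interior_subset hy
    rw [(hasDerivAt_digammaApproxDefect 0 hy).deriv]
    have : ∀ d : ℝ, d = (7 * y ^ 2 + 49 * y ^ 3 + 112 * y ^ 4 + 105 * y ^ 5 + 35 * y ^ 6) /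
        (210 * y ^ 7 * (y + 1) ^ 7) → 0 ≤ d := by
      rintro d rfl
      positivity
    apply this
    field_simp
    ring
  exact nonpos_of_le_add_one_of_tendsto_zero
    (fun y hy => hmono hy (by simp only [mem_Ioi]; positivity) (by linarith))
    (tendsto_digammaApproxDefect 0) hx

lemma digammaApproxDefect_nonneg {x : ℝ} (hx : 0 < x) :
    0 ≤ digammaApproxDefect (1 / 252) x := by
  have hanti : AntitoneOn (digammaApproxDefect (1 / 252)) (Ioi 0) := by
    refine antitoneOn_of_deriv_nonpos (convex_Ioi 0)
      (fun y hy => (hasDerivAt_digammaApproxDefect _ hy).continuousAt.continuousWithinAt)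
      (fun y hy => (hasDerivAt_digammaApproxDefect _
        (interior_subset hy)).differentiableAt.differentiableWithinAt) fun y hy => ?_
    replace hy : 0 < y := interior_subset hy
    rw [(hasDerivAt_digammaApproxDefect _ hy).deriv]
    have : ∀ d : ℝ, d = -((5 + 35 * y + 98 * y ^ 2 + 126 * y ^ 3 + 63 * y ^ 4) /
        (210 * y ^ 7 * (y + 1) ^ 7)) → d ≤ 0 := by
      rintro d rfl
      rw [neg_nonpos]
      positivity
    apply this
    field_simp
    ring
  exact nonneg_of_add_one_le_of_tendsto_zero
    (fun y hy => hanti hy (by simp only [mem_Ioi]; positivity) (by linarith))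
    (tendsto_digammaApproxDefect _) hx

/-- The real digamma function. -/
noncomputable def realDigamma (x : ℝ) : ℝ := deriv (Real.log ∘ Real.Gamma) x

lemma differentiableAt_log_Gamma {x : ℝ} (hx : 0 < x) :
    DifferentiableAt ℝ (Real.log ∘ Real.Gamma) x :=
  (Real.differentiableAt_log (Real.Gamma_pos_of_pos hx).ne').comp x
    (Real.differentiableOn_Gamma_Ioi.differentiableAt (Ioi_mem_nhds hx))

lemma log_Gamma_add_one {x : ℝ} (hx : 0 < x) :
    (Real.log ∘ Real.Gamma) (x + 1) = Real.log x + (Real.log ∘ Real.Gamma) x := by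
  simp only [Function.comp, Real.Gamma_add_one hx.ne',
    Real.log_mul hx.ne' (Real.Gamma_pos_of_pos hx).ne']

lemma realDigamma_add_one {x : ℝ} (hx : 0 < x) :
    realDigamma (x + 1) = realDigamma x + x⁻¹ := by
  have h1 := (differentiableAt_log_Gamma (by positivity : 0 < x + 1)).hasDerivAt.comp_add_const x 1
  have h2 := (Real.hasDerivAt_log hx.ne').add (differentiableAt_log_Gamma hx).hasDerivAt
  have h3 : (fun y => (Real.log ∘ Real.Gamma) (y + 1)) =ᶠ[𝓝 x]
      Real.log + Real.log ∘ Real.Gamma := by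
    filter_upwards [Ioi_mem_nhds hx] with y hy
    exact log_Gamma_add_one hy
  have := (h2.congr_of_eventuallyEq h3).unique h1
  simp only [realDigamma]
  linarith

lemma realDigamma_le_log {x : ℝ} (hx : 0 < x) : realDigamma x ≤ Real.log x := by
  have h := Real.convexOn_log_Gamma.deriv_le_slope (x := x) (y := x + 1) hx
    (by simp only [mem_Ioi]; positivity) (by linarith) (differentiableAt_log_Gamma hx)
  rw [slope_def_field, log_Gamma_add_one hx] at h
  simpa [realDigamma] using h

lemma log_sub_inv_le_realDigamma {x : ℝ} (hx : 0 < x) : Real.log x - x⁻¹ ≤ realDigamma x := by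
  have hx1 : 0 < x + 1 := by positivity
  have h := Real.convexOn_log_Gamma.slope_le_deriv (x := x) (y := x + 1) hx hx1
    (by linarith) (differentiableAt_log_Gamma hx1)
  rw [slope_def_field, log_Gamma_add_one hx] at h
  have h' : Real.log x ≤ realDigamma (x + 1) := by simpa [realDigamma] using h
  rw [realDigamma_add_one hx] at h'
  linarith

lemma tendsto_realDigamma_sub_digammaApprox (c : ℝ) :
    Tendsto (fun x => realDigamma x - digammaApprox c x) atTop (𝓝 0) := by
  have hlog : Tendsto (fun x => realDigamma x - Real.log x) atTop (𝓝 0) := by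
    have hi : Tendsto (fun x : ℝ => -x⁻¹) atTop (𝓝 0) := by
      simpa using (tendsto_inv_atTop_zero (𝕜 := ℝ)).neg
    refine tendsto_of_tendsto_of_tendsto_of_le_of_le' hi tendsto_const_nhds ?_ ?_ <;>
      filter_upwards [eventually_gt_atTop 0] with x hx
    · linarith [log_sub_inv_le_realDigamma hx]
    · linarith [realDigamma_le_log hx]
  simpa using hlog.sub (tendsto_digammaApprox_sub_log c)

lemma realDigamma_le_digammaApprox {x : ℝ} (hx : 0 < x) :
    realDigamma x ≤ digammaApprox 0 x := by
  refine sub_nonpos.1 (nonpos_of_le_add_one_of_tendsto_zero (fun y hy => ?_)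
    (tendsto_realDigamma_sub_digammaApprox 0) hx)
  have h := digammaApproxDefect_zero_nonpos hy
  rw [digammaApproxDefect] at h
  linarith [realDigamma_add_one hy]

lemma digammaApprox_le_realDigamma {x : ℝ} (hx : 0 < x) :
    digammaApprox (1 / 252) x ≤ realDigamma x := by
  refine sub_nonneg.1 (nonneg_of_add_one_le_of_tendsto_zero (fun y hy => ?_)
    (tendsto_realDigamma_sub_digammaApprox _) hx)
  have h := digammaApproxDefect_nonneg hy
  rw [digammaApproxDefect] at h
  linarith [realDigamma_add_one hy]

lemma realDigamma_add_nat {x : ℝ} (hx : 0 < x) (n : ℕ) :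
    realDigamma (x + n) = realDigamma x + ∑ k ∈ Finset.range n, (x + k)⁻¹ := by
  induction n with
  | zero => simp
  | succ n ih =>
    rw [Finset.sum_range_succ, ← add_assoc, ← ih, ← realDigamma_add_one (by positivity)]
    push_cast
    ring_nf

lemma monotoneOn_realDigamma : MonotoneOn realDigamma (Ioi 0) :=
  Real.convexOn_log_Gamma.monotoneOn_deriv fun _ hx => differentiableAt_log_Gamma hx

lemma log_sixteen_mul_one_sub {y : ℝ} (hy : y < 1) :
    Real.log (16 * (1 - y)) = 4 * Real.log 2 + Real.log (1 - y) := by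
  rw [Real.log_mul (by norm_num) (by linarith), show (16 : ℝ) = 2 ^ 4 by norm_num, Real.log_pow]
  norm_num

lemma realDigamma_neg : realDigamma 1.46163214 < 0 := by
  have h := realDigamma_le_digammaApprox (x := 1.46163214 + (14 : ℕ)) (by norm_num)
  rw [realDigamma_add_nat (by norm_num), digammaApprox,
    show (1.46163214 + (14 : ℕ) : ℝ) = 16 * (1 - 0.03364799125) by norm_num,
    log_sixteen_mul_one_sub (by norm_num)] at h
  have hlog := (abs_le.1 (Real.abs_log_sub_add_sum_range_le (x := 0.03364799125)
    (by norm_num [abs_lt]) 6)).2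
  have h2 := (abs_le.1 Real.log_two_near_10).2
  rw [abs_of_pos (by norm_num)] at hlog
  norm_num [Finset.sum_range_succ] at h hlog h2
  linarith

lemma realDigamma_pos : 0 < realDigamma 1.46163215 := by
  have h := digammaApprox_le_realDigamma (x := 1.46163215 + (14 : ℕ)) (by norm_num)
  rw [realDigamma_add_nat (by norm_num), digammaApprox,
    show (1.46163215 + (14 : ℕ) : ℝ) = 16 * (1 - 0.033647990625) by norm_num,
    log_sixteen_mul_one_sub (by norm_num)] at h
  have hlog := (abs_le.1 (Real.abs_log_sub_add_sum_range_le (x := 0.033647990625)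
    (by norm_num [abs_lt]) 6)).1
  have h2 := (abs_le.1 Real.log_two_near_10).1
  rw [abs_of_pos (by norm_num)] at hlog
  norm_num [Finset.sum_range_succ] at h hlog h2
  linarith

/-- The unique minimizer `x_m` of `Γ` on `(0,∞)` satisfies
`1.46163214 < x_m < 1.46163215`. -/
theorem Gamma_min_bounds (x : ℝ) (hx : 0 < x)
    (hmin : ∀ y : ℝ, 0 < y → Real.Gamma x ≤ Real.Gamma y) :
    1.46163214 < x ∧ x < 1.46163215 := by
  have hx0 : realDigamma x = 0 := by
    refine IsLocalMin.deriv_eq_zero ?_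
    filter_upwards [Ioi_mem_nhds hx] with y hy
    exact Real.log_le_log (Real.Gamma_pos_of_pos hx) (hmin y hy)
  constructor
  · by_contra! h
    have := monotoneOn_realDigamma hx (by norm_num : (1.46163214 : ℝ) ∈ Ioi 0) h
    linarith [realDigamma_neg]
  · by_contra! h
    have := monotoneOn_realDigamma (by norm_num : (1.46163215 : ℝ) ∈ Ioi 0) hx h
    linarith [realDigamma_pos]
end

section
/- Let $x_m$ be the unique point in $(0,\infty)$ at which the real Gamma function attains its minimum on $(0,\infty)$, and set $\eta = \gamma + \log 4 - 2$. Then the second-order Lagrange inversion approximation at $a = 3/2$ satisfies $\left| x_m - \left( \tfrac{3}{2} + \tfrac{2\eta}{\pi^{2} - 8} + \tfrac{8(7\zeta(3) - 8)\,\eta^{2}}{(\pi^{2} - 8)^{3}} \right) \right| < 10^{-5}$. -/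
/-- The Riemann zeta value `ζ(3) = ∑_{n=1}^∞ n⁻³`, as a real number. -/
noncomputable def zeta3 : ℝ := ∑' n : ℕ, 1 / ((n : ℝ) + 1) ^ 3

open Real Set Filter Topology

section Digamma

theorem Real.Gamma_ne_neg_nat_of_pos {x : ℝ} (hx : 0 < x) (m : ℕ) : x ≠ -m :=
  ((neg_nonpos.2 m.cast_nonneg).trans_lt hx).ne'

theorem Real.differentiableAt_Gamma_of_pos {x : ℝ} (hx : 0 < x) : DifferentiableAt ℝ Gamma x :=
  differentiableAt_Gamma (Gamma_ne_neg_nat_of_pos hx)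

theorem Real.monotoneOn_logDeriv_Gamma : MonotoneOn (logDeriv Gamma) (Ioi 0) := by
  have hd : ∀ x ∈ Ioi (0 : ℝ), DifferentiableAt ℝ (log ∘ Gamma) x := fun x hx =>
    (differentiableAt_Gamma_of_pos hx).log (Gamma_pos_of_pos hx).ne'
  refine (convexOn_log_Gamma.monotoneOn_deriv hd).congr fun x hx => ?_
  exact Real.deriv_log_comp_eq_logDeriv (differentiableAt_Gamma_of_pos hx)
    (Gamma_pos_of_pos hx).ne'

theorem Real.logDeriv_Gamma_add_one {x : ℝ} (hx : 0 < x) :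
    logDeriv Gamma (x + 1) = logDeriv Gamma x + x⁻¹ := by
  have hd := (differentiableAt_Gamma_of_pos hx).hasDerivAt
  have hder : HasDerivAt (fun y => Gamma (y + 1)) (1 * Gamma x + x * deriv Gamma x) x :=
    ((hasDerivAt_id x).mul hd).congr_of_eventuallyEq <| by
      filter_upwards [eventually_ne_nhds hx.ne'] with y hy using Gamma_add_one hy
  have hG := (Gamma_pos_of_pos hx).ne'
  rw [logDeriv_apply, logDeriv_apply, ← deriv_comp_add_const, hder.deriv, Gamma_add_one hx.ne']
  field_simp
  ring

theorem Real.logDeriv_Gamma_add_nat {x : ℝ} (hx : 0 < x) (n : ℕ) :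
    logDeriv Gamma (x + n) = logDeriv Gamma x + ∑ k ∈ Finset.range n, (x + k)⁻¹ := by
  induction n with
  | zero => simp
  | succ n ih =>
    rw [Finset.sum_range_succ, ← add_assoc, ← ih, ← logDeriv_Gamma_add_one (by positivity)]
    push_cast
    ring_nf

theorem Real.logDeriv_Gamma_one : logDeriv Gamma 1 = -eulerMascheroniConstant := by
  rw [logDeriv_apply, hasDerivAt_Gamma_one.deriv, Gamma_one, div_one]

theorem Real.log_four : log 4 = 2 * log 2 := by
  rw [show (4 : ℝ) = 2 ^ 2 by norm_num, log_pow, Nat.cast_ofNat]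

theorem Real.logDeriv_Gamma_three_halves :
    logDeriv Gamma (3 / 2) = 2 - eulerMascheroniConstant - log 4 := by
  have hπ : √π ≠ 0 := by positivity
  rw [show (3 / 2 : ℝ) = 1 / 2 + 1 by norm_num, logDeriv_Gamma_add_one (by norm_num),
    logDeriv_apply, hasDerivAt_Gamma_one_half.deriv, Gamma_one_half_eq, log_four]
  field_simp
  ring

/-- The series expansion of a difference of values of the digamma function. -/
theorem Real.hasSum_logDeriv_Gamma_sub {x y : ℝ} (hx : 0 < x) (hxy : x ≤ y) (hyx : y ≤ x + 1) :
    HasSum (fun k : ℕ => (x + k)⁻¹ - (y + k)⁻¹) (logDeriv Gamma y - logDeriv Gamma x) := by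
  have hy : 0 < y := hx.trans_le hxy
  rw [hasSum_iff_tendsto_nat_of_nonneg fun k =>
    sub_nonneg.2 (inv_anti₀ (by positivity) (by linarith))]
  have hsum : ∀ n : ℕ, ∑ k ∈ Finset.range n, ((x + k)⁻¹ - (y + k)⁻¹) =
      logDeriv Gamma y - logDeriv Gamma x -
        (logDeriv Gamma (y + n) - logDeriv Gamma (x + n)) := fun n => by
    rw [Finset.sum_sub_distrib, logDeriv_Gamma_add_nat hx, logDeriv_Gamma_add_nat hy]
    ring
  simp_rw [hsum]
  have hinv : Tendsto (fun n : ℕ => (x + n)⁻¹) atTop (𝓝 0) :=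
    tendsto_inv_atTop_zero.comp (tendsto_atTop_add_const_left _ x tendsto_natCast_atTop_atTop)
  have hlim : Tendsto (fun n : ℕ => logDeriv Gamma (y + n) - logDeriv Gamma (x + n))
      atTop (𝓝 0) := by
    refine tendsto_of_tendsto_of_tendsto_of_le_of_le tendsto_const_nhds hinv
      (fun n => ?_) (fun n => ?_)
    · exact sub_nonneg.2 (monotoneOn_logDeriv_Gamma (mem_Ioi.2 (by positivity))
        (mem_Ioi.2 (by positivity)) (by linarith))
    · have hmono := monotoneOn_logDeriv_Gamma (a := y + n) (b := x + n + 1)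
        (mem_Ioi.2 (by positivity)) (mem_Ioi.2 (by positivity)) (by linarith)
      rw [logDeriv_Gamma_add_one (by positivity)] at hmono
      simpa [sub_le_iff_le_add', add_comm] using hmono
  simpa using hlim.const_sub (logDeriv Gamma y - logDeriv Gamma x)

end Digamma

section EulerMascheroni

theorem Real.log_le_half_sub_inv {y : ℝ} (hy : 1 ≤ y) : log y ≤ (y - y⁻¹) / 2 := by
  rw [← sinh_log (by linarith)]
  exact self_le_sinh_iff.2 (log_nonneg hy)

/-- The lower bound for `γ` coming from the trapezoidal rule. -/
theorem Real.harmonic_sub_log_sub_le_eulerMascheroniConstant {n : ℕ} (hn : n ≠ 0) :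
    (harmonic n : ℝ) - log n - 1 / (2 * n) ≤ eulerMascheroniConstant := by
  have hlim : Tendsto (fun k : ℕ => (harmonic k : ℝ) - log k - 1 / (2 * k)) atTop
      (𝓝 (eulerMascheroniConstant - 0)) := by
    refine tendsto_harmonic_sub_log.sub ?_
    have := (tendsto_inv_atTop_zero.comp (tendsto_natCast_atTop_atTop (R := ℝ))).const_mul
      (1 / 2 : ℝ)
    refine (this.congr fun k => ?_).trans (by simp)
    simp [mul_comm]
  rw [sub_zero] at hlim
  refine ge_of_tendsto hlim (eventually_atTop.2 ⟨n, fun m hm => ?_⟩)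
  induction m, hm using Nat.le_induction with
  | base => exact le_rfl
  | succ m hm ih =>
    refine ih.trans ?_
    have hm0 : (0 : ℝ) < m := by exact_mod_cast (Nat.pos_of_ne_zero hn).trans_le hm
    have hlog := log_le_half_sub_inv (y := (m + 1) / m) (by rw [le_div_iff₀ hm0]; linarith)
    rw [log_div (by positivity) hm0.ne'] at hlog
    have hid : (((m + 1) / m : ℝ) - ((m + 1) / m : ℝ)⁻¹) / 2 =
        1 / (2 * m) + 1 / (2 * (m + 1)) := by
      field_simp
      ring
    have hhalf : ((m + 1 : ℝ))⁻¹ = 2 * (1 / (2 * (m + 1))) := by field_simp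
    rw [harmonic_succ]
    push_cast
    linarith

/-- The upper bound for `γ` coming from the midpoint rule. -/
theorem Real.eulerMascheroniConstant_le_harmonic_sub_log_add_half (n : ℕ) :
    eulerMascheroniConstant ≤ (harmonic n : ℝ) - log (n + 1 / 2) := by
  have hlim : Tendsto (fun k : ℕ => (harmonic k : ℝ) - log (k + 1 / 2)) atTop
      (𝓝 eulerMascheroniConstant) := by
    refine tendsto_of_tendsto_of_tendsto_of_le_of_le' tendsto_harmonic_sub_log_add_one
      tendsto_harmonic_sub_log (Eventually.of_forall fun k => ?_) ?_
    · have : log ((k : ℝ) + 1 / 2) ≤ log (k + 1) := log_le_log (by positivity) (by linarith)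
      linarith
    · filter_upwards [eventually_gt_atTop 0] with k hk
      have : log (k : ℝ) ≤ log (k + 1 / 2) := log_le_log (by positivity) (by linarith)
      linarith
  refine le_of_tendsto hlim (eventually_atTop.2 ⟨n, fun m hm => ?_⟩)
  induction m, hm using Nat.le_induction with
  | base => exact le_rfl
  | succ m hm ih =>
    refine le_trans ?_ ih
    have hlog := le_log_one_add_of_nonneg (x := 1 / ((m : ℝ) + 1 / 2)) (by positivity)
    have hleft : 2 * (1 / ((m : ℝ) + 1 / 2)) / (1 / ((m : ℝ) + 1 / 2) + 2) = ((m : ℝ) + 1)⁻¹ := by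
      field_simp
      ring
    have hright : 1 + 1 / ((m : ℝ) + 1 / 2) = (m + 1 + 1 / 2) / (m + 1 / 2) := by
      field_simp
      ring
    rw [hleft, hright, log_div (by positivity) (by positivity)] at hlog
    rw [harmonic_succ]
    push_cast
    linarith

theorem Real.lt_eulerMascheroniConstant_add_log_four :
    1.9634 < eulerMascheroniConstant + log 4 := by
  have hle := harmonic_sub_log_sub_le_eulerMascheroniConstant (n := 32) (by norm_num)
  have hh : harmonic 32 = 586061125622639 / 144403552893600 := by
    norm_num [harmonic, Finset.sum_range_succ]
  have h32 : log ((32 : ℕ) : ℝ) = 5 * log 2 := by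
    rw [show ((32 : ℕ) : ℝ) = 2 ^ 5 by norm_num, log_pow]
    norm_num
  rw [hh, h32] at hle
  rw [log_four]
  push_cast at hle
  norm_num at hle
  linarith [log_two_lt_d9]

theorem Real.eulerMascheroniConstant_add_log_four_lt :
    eulerMascheroniConstant + log 4 < 1.9636 := by
  have hle := eulerMascheroniConstant_le_harmonic_sub_log_add_half 32
  have hh : harmonic 32 = 586061125622639 / 144403552893600 := by
    norm_num [harmonic, Finset.sum_range_succ]
  have h32 : 5 * log 2 + 2 / 129 ≤ log (((32 : ℕ) : ℝ) + 1 / 2) := by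
    have hlog := le_log_one_add_of_nonneg (x := 1 / 64) (by norm_num)
    rw [show ((32 : ℕ) : ℝ) + 1 / 2 = 2 ^ 5 * (1 + 1 / 64) by norm_num,
      log_mul (by norm_num) (by norm_num), log_pow]
    norm_num at hlog ⊢
    linarith
  rw [hh] at hle
  rw [log_four]
  push_cast at hle h32
  norm_num at hle h32
  linarith [log_two_gt_d9]

end EulerMascheroni

section OddSums

/-- The sum of `1 / (k + 3/2) ^ p` in terms of the sum of `1 / n ^ p`. -/
theorem hasSum_inv_pow_three_halves_add_nat {p : ℕ} {z : ℝ}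
    (hz : HasSum (fun n : ℕ => 1 / (n : ℝ) ^ p) z) :
    HasSum (fun k : ℕ => 1 / (3 / 2 + (k : ℝ)) ^ p) ((2 ^ p - 1) * z - 2 ^ p) := by
  have heven : HasSum (fun k : ℕ => (1 : ℝ) / ((2 * k : ℕ) : ℝ) ^ p) (1 / 2 ^ p * z) := by
    refine (hz.mul_left (1 / 2 ^ p)).congr_fun fun k => ?_
    push_cast
    rw [mul_pow, div_mul_div_comm, one_mul]
  have hodd : Summable fun k : ℕ => (1 : ℝ) / ((2 * k + 1 : ℕ) : ℝ) ^ p :=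
    hz.summable.comp_injective fun a b h => by simpa using h
  have hval := (HasSum.even_add_odd (f := fun n : ℕ => 1 / (n : ℝ) ^ p) heven
    hodd.hasSum).unique hz
  have hshift := ((hasSum_nat_add_iff' (f := fun k : ℕ => (1 : ℝ) / ((2 * k + 1 : ℕ) : ℝ) ^ p)
    1).2 hodd.hasSum).mul_left (2 ^ p)
  have hsum : (2 ^ p - 1) * z - 2 ^ p = 2 ^ p * (∑' k : ℕ, (1 : ℝ) / ((2 * k + 1 : ℕ) : ℝ) ^ p -
      ∑ k ∈ Finset.range 1, (1 : ℝ) / ((2 * k + 1 : ℕ) : ℝ) ^ p) := by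
    rw [eq_sub_of_add_eq' hval]
    simp
    field_simp
  rw [hsum]
  refine hshift.congr_fun fun k => ?_
  rw [show (3 / 2 + (k : ℝ)) = ((2 * (k + 1) + 1 : ℕ) : ℝ) / 2 by push_cast; ring, div_pow,
    one_div_div, mul_one_div]

theorem hasSum_inv_sq_three_halves_add_nat :
    HasSum (fun k : ℕ => 1 / (3 / 2 + (k : ℝ)) ^ 2) (π ^ 2 / 2 - 4) := by
  have h := hasSum_inv_pow_three_halves_add_nat hasSum_zeta_two
  rwa [show ((2 : ℝ) ^ 2 - 1) * (π ^ 2 / 6) - 2 ^ 2 = π ^ 2 / 2 - 4 by ring] at h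

theorem hasSum_one_div_nat_cube : HasSum (fun n : ℕ => 1 / (n : ℝ) ^ 3) zeta3 := by
  have hs : Summable fun n : ℕ => 1 / (n : ℝ) ^ 3 :=
    Real.summable_one_div_nat_pow.2 (by norm_num)
  rw [← hasSum_nat_add_iff' 1]
  simpa [zeta3] using ((summable_nat_add_iff 1).2 hs).hasSum

theorem hasSum_inv_cube_three_halves_add_nat :
    HasSum (fun k : ℕ => 1 / (3 / 2 + (k : ℝ)) ^ 3) (7 * zeta3 - 8) := by
  have h := hasSum_inv_pow_three_halves_add_nat hasSum_one_div_nat_cube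
  rwa [show ((2 : ℝ) ^ 3 - 1) * zeta3 - 2 ^ 3 = 7 * zeta3 - 8 by ring] at h

theorem lt_seven_mul_zeta3_sub_eight : (0.38 : ℝ) < 7 * zeta3 - 8 := by
  refine lt_of_lt_of_le ?_ (sum_le_hasSum (Finset.range 4) (fun k _ => by positivity)
    hasSum_inv_cube_three_halves_add_nat)
  norm_num [Finset.sum_range_succ]

theorem seven_mul_zeta3_sub_eight_lt : 7 * zeta3 - 8 < 0.4155 := by
  have hstep : ∀ k : ℕ, 1 / (3 / 2 + (k : ℝ)) ^ 3 ≤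
      1 / (2 * ((k : ℝ) + 1) ^ 2) - 1 / (2 * ((k : ℝ) + 2) ^ 2) := fun k => by
    rw [div_sub_div _ _ (by positivity) (by positivity), div_le_div_iff₀ (by positivity)
      (by positivity)]
    have hk : (0 : ℝ) ≤ k := k.cast_nonneg
    rw [← sub_nonneg]
    ring_nf
    positivity
  have hpart : ∀ n : ℕ, 4 ≤ n → ∑ k ∈ Finset.range n, 1 / (3 / 2 + (k : ℝ)) ^ 3 ≤
      0.4153 - 1 / (2 * ((n : ℝ) + 1) ^ 2) := fun n hn => by
    induction n, hn using Nat.le_induction with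
    | base => norm_num [Finset.sum_range_succ]
    | succ n hn ih =>
      rw [Finset.sum_range_succ]
      push_cast
      have := hstep n
      rw [show (n : ℝ) + 1 + 1 = n + 2 by ring]
      linarith
  refine lt_of_le_of_lt (le_of_tendsto hasSum_inv_cube_three_halves_add_nat.tendsto_sum_nat
    (eventually_atTop.2 ⟨4, fun n hn => (hpart n hn).trans (sub_le_self _ (by positivity))⟩)) ?_
  norm_num

end OddSums

/-- The error of second-order Lagrange inversion, for the equation
`A * (-p) - B * p ^ 2 - C * p ^ 3 = η`. -/
theorem lagrange_inversion_error_eq {A B C p η : ℝ} (hA : A ≠ 0)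
    (hη : -η = p * A + p ^ 2 * B + p ^ 3 * C) :
    -p - (η / A + B * η ^ 2 / A ^ 3) = p ^ 3 * (C / A -
      B / A * (B / A + C / A * p) * (2 + p * (B / A + C / A * p))) := by
  rw [← neg_sq η, show η / A = -(-η / A) by ring, hη]
  field_simp
  ring

theorem abs_lagrange_inversion_error_lt {A B C p η : ℝ} (hA : 0.934 < A) (hA' : A < 0.935)
    (hB : 0.38 < B) (hB' : B < 0.4155) (hC : 0.2343 < C) (hC' : (3 / 2 - p) * C ≤ B)
    (hp : 0 < p) (hη : -η < 0.0366) (hpη : -η = p * A + p ^ 2 * B + p ^ 3 * C) :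
    |-p - (η / A + B * η ^ 2 / A ^ 3)| < 1 / 100000 := by
  have hA0 : 0 < A := by linarith
  have hp1 : p < 0.0392 := by
    have h1 : 0 < p ^ 2 * B := by positivity
    have h2 : 0 < p ^ 3 * C := by positivity
    nlinarith
  have hC1 : C < 0.285 := by nlinarith
  rw [lagrange_inversion_error_eq hA0.ne' hpη]
  have hb : 0.4 < B / A := by rw [lt_div_iff₀ hA0]; linarith
  have hb' : B / A < 0.4449 := by rw [div_lt_iff₀ hA0]; linarith
  have hc : 0.2505 < C / A := by rw [lt_div_iff₀ hA0]; linarith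
  have hc' : C / A < 0.3052 := by rw [div_lt_iff₀ hA0]; linarith
  generalize B / A = b at *
  generalize C / A = c at *
  have hq : 0.4 ≤ b + c * p := by nlinarith [mul_pos (by linarith : 0 < c) hp]
  have hq' : b + c * p ≤ 0.4569 := by
    have : c * p ≤ 0.3052 * 0.0392 := by gcongr
    linarith
  generalize b + c * p = q at *
  have hp3 : p ^ 3 ≤ 0.0392 ^ 3 := by gcongr
  have hp0 : 0 < p ^ 3 := by positivity
  have hlow : 0.4 * 0.4 * (2 + 0) ≤ b * q * (2 + p * q) := by
    gcongr
    positivity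
  have hupp : b * q * (2 + p * q) ≤ 0.4449 * 0.4569 * (2 + 0.0392 * 0.4569) := by gcongr
  have hneg : c - b * q * (2 + p * q) < 0 := by linarith
  have hbd : -0.1597 ≤ c - b * q * (2 + p * q) := by linarith
  rw [abs_of_neg (mul_neg_of_pos_of_neg hp0 hneg)]
  nlinarith

theorem Real.logDeriv_Gamma_eq_zero_of_forall_le {x : ℝ} (hx : 0 < x)
    (hmin : ∀ y : ℝ, 0 < y → Gamma x ≤ Gamma y) : logDeriv Gamma x = 0 := by
  have hloc : IsLocalMin Gamma x := by
    filter_upwards [eventually_gt_nhds hx] with y hy using hmin y hy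
  rw [logDeriv_apply, hloc.deriv_eq_zero, zero_div]

/-- Second-order Lagrange inversion approximation at `a = 3/2` for the minimizer of `Γ`:
with `η = γ + log 4 - 2`,
`|x_m - (3/2 + 2η/(π² - 8) + 8(7ζ(3) - 8)η²/(π² - 8)³)| < 10⁻⁵`. -/
theorem Gamma_min_second_order_approx (x : ℝ) (hx : 0 < x)
    (hmin : ∀ y : ℝ, 0 < y → Real.Gamma x ≤ Real.Gamma y)
    (η : ℝ) (hη : η = Real.eulerMascheroniConstant + Real.log 4 - 2) :
    |x - (3 / 2 + 2 * η / (Real.pi ^ 2 - 8) +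
        8 * (7 * zeta3 - 8) * η ^ 2 / (Real.pi ^ 2 - 8) ^ 3)| < 1 / 100000 := by
  have hη_lo : -η < 0.0366 := by linarith [lt_eulerMascheroniConstant_add_log_four]
  have hη_hi : 0 < -η := by linarith [eulerMascheroniConstant_add_log_four_lt]
  have hψ := logDeriv_Gamma_eq_zero_of_forall_le hx hmin
  have hψ' : logDeriv Gamma (3 / 2) = -η := by
    rw [logDeriv_Gamma_three_halves, hη]
    ring
  have hx1 : 1 < x := by
    by_contra! h
    have := monotoneOn_logDeriv_Gamma (mem_Ioi.2 hx) (mem_Ioi.2 one_pos) h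
    rw [hψ, logDeriv_Gamma_one] at this
    linarith [one_half_lt_eulerMascheroniConstant]
  have hx2 : x < 3 / 2 := by
    by_contra! h
    have := monotoneOn_logDeriv_Gamma (a := 3 / 2) (mem_Ioi.2 (by norm_num)) (mem_Ioi.2 hx) h
    rw [hψ, hψ'] at this
    linarith
  obtain ⟨p, rfl⟩ : ∃ p, x = 3 / 2 - p := ⟨3 / 2 - x, by ring⟩
  have hp : 0 < p := by linarith
  have hsum := hasSum_logDeriv_Gamma_sub hx hx2.le (by linarith)
  rw [hψ, hψ', sub_zero] at hsum
  have hA := hasSum_inv_sq_three_halves_add_nat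
  have hB := hasSum_inv_cube_three_halves_add_nat
  have hpos : ∀ k : ℕ, 0 < 3 / 2 - p + k := fun k => by positivity
  obtain ⟨C, hCη, hC⟩ : ∃ C, -η = p * (π ^ 2 / 2 - 4) + p ^ 2 * (7 * zeta3 - 8) + p ^ 3 * C ∧
      HasSum (fun k : ℕ => 1 / ((3 / 2 + (k : ℝ)) ^ 3 * (3 / 2 - p + k))) C := by
    refine ⟨(-η - p * (π ^ 2 / 2 - 4) - p ^ 2 * (7 * zeta3 - 8)) / p ^ 3, by field_simp; ring, ?_⟩
    refine (((hsum.sub (hA.mul_left p)).sub (hB.mul_left (p ^ 2))).div_const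
      (p ^ 3)).congr_fun fun k => ?_
    have hak : 3 / 2 - p + k = 3 / 2 + k - p := by ring
    have hap := hak ▸ (hpos k).ne'
    have ha : (3 / 2 + k : ℝ) ≠ 0 := by positivity
    rw [hak]
    generalize (3 / 2 + k : ℝ) = a at *
    field_simp
    ring
  have hC_lo : 0.2343 < C := by
    have hle : ∑ k ∈ Finset.range 8, 1 / (3 / 2 + (k : ℝ)) ^ 4 ≤ C := by
      refine (Finset.sum_le_sum fun k _ => ?_).trans (sum_le_hasSum (Finset.range 8)
        (fun k _ => (by have := hpos k; positivity)) hC)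
      have := hpos k
      rw [pow_succ _ 3]
      gcongr
    refine lt_of_lt_of_le ?_ hle
    norm_num [Finset.sum_range_succ]
  have hC_hi : (3 / 2 - p) * C ≤ 7 * zeta3 - 8 := by
    refine hasSum_le (fun k => ?_) (hC.mul_left (3 / 2 - p)) hB
    have := hpos k
    rw [mul_one_div, div_le_div_iff₀ (by positivity) (by positivity), one_mul, mul_comm]
    gcongr
    linarith [(k.cast_nonneg : (0 : ℝ) ≤ k)]
  have hmain := abs_lagrange_inversion_error_lt (by nlinarith [pi_gt_d4]) (by nlinarith [pi_lt_d4, pi_pos])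
    lt_seven_mul_zeta3_sub_eight seven_mul_zeta3_sub_eight_lt hC_lo hC_hi hp hη_lo hCη
  have hD : π ^ 2 / 2 - 4 ≠ 0 := by nlinarith [pi_gt_d4]
  have hscale : π ^ 2 - 8 = 2 * (π ^ 2 / 2 - 4) := by ring
  convert hmain using 2
  rw [hscale]
  generalize π ^ 2 / 2 - 4 = A at *
  field_simp
  ring
end

section
/- Let $x_m$ be the unique point in $(0,\infty)$ at which the real Gamma function attains its minimum on $(0,\infty)$. Then the second-order Lagrange inversion approximation at $a = 1$ satisfies $\left| x_m - \left( 1 + \tfrac{\gamma}{\zeta(2)} + \tfrac{\zeta(3)\,\gamma^{2}}{\zeta(2)^{3}} \right) \right| < \tfrac{1}{40}$. -/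
/-- The Riemann zeta value `ζ(2) = ∑_{n=1}^∞ n⁻²`, as a real number. -/
noncomputable def zeta2 : ℝ := ∑' n : ℕ, 1 / ((n : ℝ) + 1) ^ 2

open Filter Topology

theorem Real.hasDerivAt_log_Gamma {y : ℝ} (hy : 0 < y) :
    HasDerivAt (Real.log ∘ Real.Gamma) (logDeriv Real.Gamma y) y :=
  (Real.differentiableAt_Gamma fun m h => by
    have : (0 : ℝ) ≤ m := m.cast_nonneg
    linarith).hasDerivAt.log (Real.Gamma_pos_of_pos hy).ne'

theorem Real.logDeriv_Gamma_monotoneOn : MonotoneOn (logDeriv Real.Gamma) (Set.Ioi 0) := by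
  have h := Real.convexOn_log_Gamma.monotoneOn_deriv fun y hy =>
    (Real.hasDerivAt_log_Gamma hy).differentiableAt
  intro a ha b hb hab
  have := h ha hb hab
  rwa [(Real.hasDerivAt_log_Gamma ha).deriv, (Real.hasDerivAt_log_Gamma hb).deriv] at this

theorem Real.log_Gamma_add_one {y : ℝ} (hy : 0 < y) :
    Real.log (Real.Gamma (y + 1)) = Real.log y + Real.log (Real.Gamma y) := by
  rw [Real.Gamma_add_one hy.ne', Real.log_mul hy.ne' (Real.Gamma_pos_of_pos hy).ne']

theorem Real.logDeriv_Gamma_add_one_s19 {y : ℝ} (hy : 0 < y) :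
    logDeriv Real.Gamma (y + 1) = logDeriv Real.Gamma y + 1 / y := by
  have h1 := (Real.hasDerivAt_log_Gamma (y := y + 1) (by linarith)).comp_add_const y 1
  have h2 := (Real.hasDerivAt_log hy.ne').add (Real.hasDerivAt_log_Gamma hy)
  have h3 := h1.congr_of_eventuallyEq (f₁ := Real.log + Real.log ∘ Real.Gamma) (by
    filter_upwards [lt_mem_nhds hy] with z hz
    simp [Real.log_Gamma_add_one hz])
  rw [h3.unique h2]
  ring

theorem Real.logDeriv_Gamma_add_nat_s19 {y : ℝ} (hy : 0 < y) (n : ℕ) :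
    logDeriv Real.Gamma (y + n) =
      logDeriv Real.Gamma y + ∑ k ∈ Finset.range n, 1 / (y + k) := by
  induction n with
  | zero => simp
  | succ n ih =>
    rw [Finset.sum_range_succ, ← add_assoc, ← ih, ← Real.logDeriv_Gamma_add_one_s19 (by positivity)]
    push_cast
    ring_nf

theorem Real.logDeriv_Gamma_le_log {y : ℝ} (hy : 0 < y) :
    logDeriv Real.Gamma y ≤ Real.log y := by
  have h := Real.convexOn_log_Gamma.le_slope_of_hasDerivAt (x := y) (y := y + 1) hy
    (by simp only [Set.mem_Ioi]; linarith) (by linarith) (Real.hasDerivAt_log_Gamma hy)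
  simpa [slope_def_field, Real.log_Gamma_add_one hy] using h

theorem Real.log_sub_one_le_logDeriv_Gamma {y : ℝ} (hy : 1 < y) :
    Real.log (y - 1) ≤ logDeriv Real.Gamma y := by
  have hy' : 0 < y - 1 := by linarith
  have h := Real.convexOn_log_Gamma.slope_le_of_hasDerivAt (x := y - 1) (y := y) hy'
    (by simp only [Set.mem_Ioi]; linarith) (by linarith)
    (Real.hasDerivAt_log_Gamma (by linarith))
  have h2 := Real.log_Gamma_add_one hy'
  rw [sub_add_cancel] at h2
  simpa [slope_def_field, h2] using h

theorem nonneg_of_antitone_shift {f : ℝ → ℝ} {a c y : ℝ} (hy : a < y)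
    (hstep : ∀ z, a < z → f (z + 1) ≤ f z) (hlow : ∀ z, 1 < z → a < z → -c / (z - 1) ≤ f z) :
    0 ≤ f y := by
  have hshift : ∀ n : ℕ, f (y + n) ≤ f y := by
    intro n
    induction n with
    | zero => simp
    | succ n ih =>
      have h0 : (0 : ℝ) ≤ n := n.cast_nonneg
      refine le_trans ?_ ih
      have := hstep (y + n) (by linarith)
      push_cast
      rwa [← add_assoc]
  have ht : Tendsto (fun n : ℕ => -c / (y + n - 1)) atTop (𝓝 0) := by
    refine Tendsto.const_div_atTop ?_ _
    exact tendsto_atTop_add_const_right _ _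
      (tendsto_atTop_add_const_left _ _ tendsto_natCast_atTop_atTop)
  refine le_of_tendsto ht ?_
  obtain ⟨N, hN⟩ := exists_nat_gt (1 - y)
  filter_upwards [eventually_ge_atTop N] with n hn
  have h1 : (N : ℝ) ≤ n := by exact_mod_cast hn
  have h0 : (0 : ℝ) ≤ n := n.cast_nonneg
  exact (hlow _ (by linarith) (by linarith)).trans (hshift n)

theorem Real.log_le_half_sub_inv_s19 {t : ℝ} (ht : 1 ≤ t) : Real.log t ≤ (t - t⁻¹) / 2 := by
  rw [← Real.sinh_log (by linarith)]
  exact Real.self_le_sinh_iff.2 (Real.log_nonneg ht)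

theorem Real.logDeriv_Gamma_le {y : ℝ} (hy : 0 < y) :
    logDeriv Real.Gamma y ≤ Real.log y - 1 / (2 * y) := by
  refine sub_nonneg.1 (nonneg_of_antitone_shift
    (f := fun z => Real.log z - 1 / (2 * z) - logDeriv Real.Gamma z) (a := 0) (c := 1 / 2) hy ?_ ?_)
  · intro z hz
    have h1 := Real.log_le_half_sub_inv_s19 (t := (z + 1) / z) (by rw [le_div_iff₀ hz]; linarith)
    rw [Real.log_div (by positivity) hz.ne', inv_div] at h1
    simp only [Real.logDeriv_Gamma_add_one_s19 hz]
    have h2 : ((z + 1) / z - z / (z + 1)) / 2 = 1 / z - 1 / (2 * z) + 1 / (2 * (z + 1)) := by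
      field_simp
      ring
    linarith
  · intro z hz hz0
    have h1 := Real.logDeriv_Gamma_le_log hz0
    have h2 : 1 / (2 * z) ≤ 1 / (2 * (z - 1)) :=
      one_div_le_one_div_of_le (by linarith) (by linarith)
    have h3 : -(1 / 2) / (z - 1) = -(1 / (2 * (z - 1))) := by
      have : z - 1 ≠ 0 := by linarith
      field_simp
    linarith

theorem Real.log_sub_half_le_logDeriv_Gamma {y : ℝ} (hy : 1 / 2 < y) :
    Real.log (y - 1 / 2) ≤ logDeriv Real.Gamma y := by
  refine sub_nonneg.1 (nonneg_of_antitone_shift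
    (f := fun z => logDeriv Real.Gamma z - Real.log (z - 1 / 2)) (a := 1 / 2) (c := 1 / 2) hy ?_ ?_)
  · intro z hz
    have hz0 : 0 < z := by linarith
    have hz' : 0 < z - 1 / 2 := by linarith
    have h1 := Real.le_log_one_add_of_nonneg (x := 1 / (z - 1 / 2)) (by positivity)
    have h2 : 2 * (1 / (z - 1 / 2)) / (1 / (z - 1 / 2) + 2) = 1 / z := by
      have h4 := one_div_mul_cancel hz'.ne'
      rw [div_eq_div_iff (by positivity) hz0.ne']
      linear_combination 2 * h4
    have h3 : 1 + 1 / (z - 1 / 2) = (z + 1 - 1 / 2) / (z - 1 / 2) := by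
      rw [eq_div_iff hz'.ne', add_mul, one_div_mul_cancel hz'.ne']
      ring
    rw [h2, h3, Real.log_div (by linarith) hz'.ne'] at h1
    simp only [Real.logDeriv_Gamma_add_one_s19 hz0]
    linarith
  · intro z hz _
    have hz' : 0 < z - 1 := by linarith
    have h1 := Real.log_sub_one_le_logDeriv_Gamma hz
    have h2 := Real.log_le_sub_one_of_pos (x := (z - 1 / 2) / (z - 1))
      (div_pos (by linarith) hz')
    rw [Real.log_div (by linarith) hz'.ne'] at h2
    have h3 : -(1 / 2) / (z - 1) = -((z - 1 / 2) / (z - 1) - 1) := by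
      field_simp
      ring
    linarith

theorem Real.logDeriv_Gamma_one_s19 : logDeriv Real.Gamma 1 = -Real.eulerMascheroniConstant := by
  simp [logDeriv_apply, Real.eulerMascheroniConstant_eq_neg_deriv]

theorem Real.eulerMascheroniConstant_gt_5768 : 0.5768 < Real.eulerMascheroniConstant := by
  have h := Real.logDeriv_Gamma_le (y := 1 + (15 : ℕ)) (by positivity)
  rw [Real.logDeriv_Gamma_add_nat_s19 one_pos, Real.logDeriv_Gamma_one_s19] at h
  have h16 : Real.log (1 + (15 : ℕ)) = 4 * Real.log 2 := by
    rw [show (1 + (15 : ℕ) : ℝ) = 2 ^ 4 by norm_num, Real.log_pow]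
    norm_num
  rw [h16] at h
  norm_num [Finset.sum_range_succ] at h ⊢
  linarith [Real.log_two_lt_d9]

theorem Real.eulerMascheroniConstant_lt_579 : Real.eulerMascheroniConstant < 0.579 := by
  have h := Real.log_sub_half_le_logDeriv_Gamma (y := 1 + (15 : ℕ)) (by norm_num)
  rw [Real.logDeriv_Gamma_add_nat_s19 one_pos, Real.logDeriv_Gamma_one_s19] at h
  have h16 : Real.log (1 + (15 : ℕ) - 1 / 2) = 4 * Real.log 2 + Real.log (31 / 32) := by
    rw [show (1 + (15 : ℕ) - 1 / 2 : ℝ) = 2 ^ 4 * (31 / 32) by norm_num,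
      Real.log_mul (by norm_num) (by norm_num), Real.log_pow]
    norm_num
  have h1 := Real.one_sub_inv_le_log_of_pos (x := 31 / 32) (by norm_num)
  rw [h16] at h
  norm_num [Finset.sum_range_succ] at h h1 ⊢
  linarith [Real.log_two_gt_d9]

theorem Real.logDeriv_Gamma_pos_of_le {y : ℝ} (hy : 1.464 ≤ y) : 0 < logDeriv Real.Gamma y := by
  refine lt_of_lt_of_le ?_ (Real.logDeriv_Gamma_monotoneOn (a := 1.464)
    (by norm_num [Set.mem_Ioi]) (by simp only [Set.mem_Ioi]; norm_num at hy; linarith) hy)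
  have h := Real.log_sub_half_le_logDeriv_Gamma (y := 1.464 + (15 : ℕ)) (by norm_num)
  rw [Real.logDeriv_Gamma_add_nat_s19 (by norm_num)] at h
  have h16 : Real.log (1.464 + (15 : ℕ) - 1 / 2) = 4 * Real.log 2 + Real.log (3991 / 4000) := by
    rw [show (1.464 + (15 : ℕ) - 1 / 2 : ℝ) = 2 ^ 4 * (3991 / 4000) by norm_num,
      Real.log_mul (by norm_num) (by norm_num), Real.log_pow]
    norm_num
  have h1 := Real.one_sub_inv_le_log_of_pos (x := 3991 / 4000) (by norm_num)
  rw [h16] at h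
  norm_num [Finset.sum_range_succ] at h h1 ⊢
  linarith [Real.log_two_gt_d9]

theorem Real.logDeriv_Gamma_neg_of_le {y : ℝ} (hy0 : 0 < y) (hy : y ≤ 1.43) :
    logDeriv Real.Gamma y < 0 := by
  refine lt_of_le_of_lt (Real.logDeriv_Gamma_monotoneOn (b := 1.43) hy0
    (by norm_num [Set.mem_Ioi]) hy) ?_
  have h := Real.logDeriv_Gamma_le (y := 1.43 + (15 : ℕ)) (by norm_num)
  rw [Real.logDeriv_Gamma_add_nat_s19 (by norm_num)] at h
  have h16 : Real.log (1.43 + (15 : ℕ)) = 4 * Real.log 2 + Real.log (1643 / 1600) := by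
    rw [show (1.43 + (15 : ℕ) : ℝ) = 2 ^ 4 * (1643 / 1600) by norm_num,
      Real.log_mul (by norm_num) (by norm_num), Real.log_pow]
    norm_num
  have h1 := Real.log_le_sub_one_of_pos (x := 1643 / 1600) (by norm_num)
  rw [h16] at h
  norm_num [Finset.sum_range_succ] at h h1 ⊢
  linarith [Real.log_two_lt_d9]

theorem hasSum_zeta2 : HasSum (fun n : ℕ => 1 / ((n : ℝ) + 1) ^ 2) (Real.pi ^ 2 / 6) := by
  have h := (hasSum_nat_add_iff' 1).2 hasSum_zeta_two
  simpa using h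

theorem zeta2_eq : zeta2 = Real.pi ^ 2 / 6 := hasSum_zeta2.tsum_eq

theorem summable_zeta3 : Summable (fun n : ℕ => 1 / ((n : ℝ) + 1) ^ 3) := by
  have h := (summable_nat_add_iff 1).2 (Real.summable_one_div_nat_pow.2 (by norm_num : 1 < 3))
  simpa using h

theorem zeta3_gt : 1.197 < zeta3 := by
  refine lt_of_lt_of_le ?_ (summable_zeta3.sum_le_tsum (Finset.range 10)
    fun n _ => by positivity)
  norm_num [Finset.sum_range_succ]

theorem zeta3_le : zeta3 ≤ 9 / 8 + (zeta2 - 5 / 4) / 3 := by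
  have h2 := hasSum_zeta2.summable.sum_add_tsum_nat_add 2
  have h3 := summable_zeta3.sum_add_tsum_nat_add 2
  have h : ∑' n : ℕ, 1 / (((n + 2 : ℕ) : ℝ) + 1) ^ 3 ≤
      ∑' n : ℕ, 1 / 3 * (1 / (((n + 2 : ℕ) : ℝ) + 1) ^ 2) := by
    refine Summable.tsum_le_tsum (fun n => ?_) ((summable_nat_add_iff 2).2 summable_zeta3)
      (((summable_nat_add_iff 2).2 hasSum_zeta2.summable).mul_left _)
    have h0 : (0 : ℝ) ≤ n := n.cast_nonneg
    rw [div_mul_div_comm, one_mul]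
    refine one_div_le_one_div_of_le (by positivity) ?_
    rw [pow_succ' _ 2]
    gcongr
    push_cast
    linarith
  rw [tsum_mul_left] at h
  change _ = zeta2 at h2
  change _ = zeta3 at h3
  rw [← h2, ← h3]
  simp only [Finset.sum_range_succ, Finset.sum_range_zero]
  norm_num at h ⊢
  linarith

/-- Second-order Lagrange inversion approximation at `a = 1` for the minimizer of `Γ`:
`|x_m - (1 + γ/ζ(2) + ζ(3)γ²/ζ(2)³)| < 1/40`. -/
theorem Gamma_min_second_order_approx_at_one (x : ℝ) (hx : 0 < x)
    (hmin : ∀ y : ℝ, 0 < y → Real.Gamma x ≤ Real.Gamma y) :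
    |x - (1 + Real.eulerMascheroniConstant / zeta2 +
        zeta3 * Real.eulerMascheroniConstant ^ 2 / zeta2 ^ 3)| < 1 / 40 := by
  have hloc : IsLocalMin Real.Gamma x := by
    filter_upwards [lt_mem_nhds hx] with y hy using hmin y hy
  have hcrit : logDeriv Real.Gamma x = 0 := by
    rw [logDeriv_apply, hloc.deriv_eq_zero, zero_div]
  have hxu : x < 1.464 := by
    by_contra! h
    exact (Real.logDeriv_Gamma_pos_of_le h).ne' hcrit
  have hxl : 1.43 < x := by
    by_contra! h
    exact (Real.logDeriv_Gamma_neg_of_le hx h).ne hcrit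
  have hz2l : 1.6449 < zeta2 := by
    rw [zeta2_eq]
    nlinarith [Real.pi_gt_d6]
  have hz2u : zeta2 < 1.645 := by
    rw [zeta2_eq]
    nlinarith [Real.pi_lt_d6, Real.pi_pos]
  have hz3l := zeta3_gt
  have hz3u : zeta3 < 1.26 := by
    have := zeta3_le
    norm_num at hz2u ⊢
    linarith
  have hgl := Real.eulerMascheroniConstant_gt_5768
  have hgu := Real.eulerMascheroniConstant_lt_579
  set g := Real.eulerMascheroniConstant
  have hg : 0 < g := lt_trans (by norm_num) hgl
  have hz2 : 0 < zeta2 := lt_trans (by norm_num) hz2l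
  have hz3 : 0 < zeta3 := lt_trans (by norm_num) hz3l
  have l1 : 0.5768 / 1.645 ≤ g / zeta2 := by gcongr
  have u1 : g / zeta2 ≤ 0.579 / 1.6449 := by gcongr
  have l2 : 1.197 * 0.5768 ^ 2 / 1.645 ^ 3 ≤ zeta3 * g ^ 2 / zeta2 ^ 3 := by gcongr
  have u2 : zeta3 * g ^ 2 / zeta2 ^ 3 ≤ 1.26 * 0.579 ^ 2 / 1.6449 ^ 3 := by gcongr
  rw [abs_lt]
  norm_num at *
  constructor <;> linarith
end
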